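/- Proposition 2 (second claim): Let A : Ω×ℝ≥0 → [0,∞) be 𝒫-measurable, where 𝒫 is the predictable σ-algebra of the filtration (ℱ_t)_{t≥0}. Then there exists a 𝒟⊗𝒟⊗ℬ(ℝ≥0)-measurable function H : D×D×ℝ≥0 → [0,∞) such that A(ω,t) = H(X_·(ω), Z_·(ω), t) for all (ω,t) outside a P-evanescent set, such that for P-a.s. ω̃ held fixed the map (ω,t) ↦ H(X_·(ω̃), Z_·(ω), t) is 𝒫^Z-measurable, and such that for P-a.s. ω̃ ∈ Ω held fixed, the map (ω,t) ↦ H(X_·(ω), Z_·(ω̃), t) is 𝒫^X_{Z(ω̃)}-measurable, where 𝒫^X_{Z(ω̃)} is the predictable σ-algebra of the (deterministically time-changed) filtration (ℱ^X_{Z_t(ω̃)})_{t≥0}. -/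

import Mathlib

open MeasureTheory Filter Topology Set
open scoped NNReal ENNReal

noncomputable section

/-- A real-valued function on `ℝ≥0` is càdlàg: right-continuous with left limits. -/
def IsCadlag (u : ℝ≥0 → ℝ) : Prop :=
  (∀ t : ℝ≥0, ContinuousWithinAt u (Set.Ici t) t) ∧
  (∀ t : ℝ≥0, 0 < t → ∃ l : ℝ, Tendsto u (𝓝[<] t) (𝓝 l))

/-- `D`, the space of real-valued càdlàg functions on `ℝ≥0`. -/
def D : Type := {u : ℝ≥0 → ℝ // IsCadlag u}

/-- The σ-algebra `𝒟` on `D` generated by the evaluation maps `u ↦ u s`. -/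
instance : MeasurableSpace D :=
  ⨆ s : ℝ≥0, MeasurableSpace.comap (fun u : D => u.1 s) inferInstance

variable {Ω : Type*} {E : Type*}

/-- The σ-algebra generated by the `μ`-null sets (used for the augmentation `·^P`). -/
def nullSets [MeasurableSpace Ω] (μ : Measure Ω) : MeasurableSpace Ω :=
  MeasurableSpace.generateFrom {s : Set Ω | μ s = 0}

/-- The raw canonical filtration `σ(Y_s : s ≤ t)` of a process `Y`. -/
def natF [MeasurableSpace E] (Y : ℝ≥0 → Ω → E) (t : ℝ≥0) : MeasurableSpace Ω :=
  ⨆ s ∈ Set.Iic t, MeasurableSpace.comap (Y s) inferInstance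

/-- `ℱ^Y_t`: the right-continuous `P`-completed canonical filtration of `Y`. -/
def rcF [MeasurableSpace Ω] [MeasurableSpace E] (μ : Measure Ω) (Y : ℝ≥0 → Ω → E)
    (t : ℝ≥0) : MeasurableSpace Ω :=
  ⨅ u ∈ Set.Ioi t, (natF Y u ⊔ nullSets μ)

/-- `ℱ^Y_∞ := σ(⋃ t, ℱ^Y_t)`. -/
def rcFinf [MeasurableSpace Ω] [MeasurableSpace E] (μ : Measure Ω) (Y : ℝ≥0 → Ω → E) :
    MeasurableSpace Ω :=
  ⨆ t : ℝ≥0, rcF μ Y t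

/-- The σ-algebra generated by the whole process `Y`. -/
def sigmaProc [MeasurableSpace E] (Y : ℝ≥0 → Ω → E) : MeasurableSpace Ω :=
  ⨆ s : ℝ≥0, MeasurableSpace.comap (Y s) inferInstance

/-- `ℋ_t := (ℱ^X_∞ ∨ ℱ^Z_t)^P`. -/
def Hfilt [MeasurableSpace Ω] (μ : Measure Ω) (X : ℝ≥0 → Ω → ℝ) (Z : ℝ≥0 → Ω → ℝ≥0)
    (t : ℝ≥0) : MeasurableSpace Ω :=
  (rcFinf μ X ⊔ rcF μ Z t) ⊔ nullSets μ

/-- `ℱ_t := (ℱ^{X_Z}_t ∨ ℱ^Z_t)^P`, where `(X_Z)_t ω := X (Z t ω) ω`. -/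
def Ffilt [MeasurableSpace Ω] (μ : Measure Ω) (X : ℝ≥0 → Ω → ℝ) (Z : ℝ≥0 → Ω → ℝ≥0)
    (t : ℝ≥0) : MeasurableSpace Ω :=
  (rcF μ (fun u ω => X (Z u ω) ω) t ⊔ rcF μ Z t) ⊔ nullSets μ

/-- The predictable σ-algebra of a filtration `F`: the σ-algebra on `Ω × ℝ≥0`
generated by all left-continuous `F`-adapted processes. -/
def predSigma [MeasurableSpace Ω] (F : ℝ≥0 → MeasurableSpace Ω) :
    MeasurableSpace (Ω × ℝ≥0) :=
  ⨆ f ∈ {f : Ω × ℝ≥0 → ℝ |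
      (∀ ω t, ContinuousWithinAt (fun s => f (ω, s)) (Set.Iio t) t) ∧
      ∀ t, Measurable[F t] fun ω => f (ω, t)},
    MeasurableSpace.comap f inferInstance

section CadlagPaths

theorem measurable_eval (s : ℝ≥0) : Measurable fun u : D => u.1 s :=
  (comap_measurable _).mono (le_iSup (fun s : ℝ≥0 =>
    MeasurableSpace.comap (fun u : D => u.1 s) inferInstance) s) le_rfl

theorem measurable_toD {α : Type*} {m : MeasurableSpace α} {p : α → D}
    (h : ∀ s, Measurable fun a => (p a).1 s) : Measurable p := by
  refine Measurable.of_comap_le ?_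
  simp only [instMeasurableSpaceD, MeasurableSpace.comap_iSup]
  refine iSup_le fun s => ?_
  rw [MeasurableSpace.comap_comp]
  exact (h s).comap_le

/-- Evaluation `(u, t) ↦ u t` is jointly measurable on càdlàg paths. -/
theorem measurable_eval_prod : Measurable fun q : D × ℝ≥0 => q.1.1 q.2 := by
  have happrox (n : ℕ) : Measurable fun q : D × ℝ≥0 =>
      q.1.1 (((⌊((n : ℝ≥0) + 1) * q.2⌋₊ : ℝ≥0) + 1) / (n + 1)) := by
    have h1 : Measurable fun q : D × ℕ => q.1.1 (((q.2 : ℝ≥0) + 1) / (n + 1)) :=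
      measurable_from_prod_countable_left fun k => measurable_eval (((k : ℝ≥0) + 1) / (n + 1))
    have h2 : Measurable fun q : D × ℝ≥0 => (q.1, ⌊((n : ℝ≥0) + 1) * q.2⌋₊) :=
      measurable_fst.prodMk (Nat.measurable_floor.comp (measurable_snd.const_mul _))
    exact h1.comp h2
  refine measurable_of_tendsto_metrizable happrox (tendsto_pi_nhds.2 fun q => ?_)
  have hpos (n : ℕ) : (0 : ℝ≥0) < n + 1 := by positivity
  refine (q.1.2.1 q.2).tendsto.comp (tendsto_nhdsWithin_iff.2 ⟨?_, .of_forall fun n => ?_⟩)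
  · refine tendsto_of_tendsto_of_tendsto_of_le_of_le (g := fun _ => q.2)
      (h := fun n : ℕ => q.2 + 1 / ((n : ℝ≥0) + 1)) tendsto_const_nhds ?_ ?_ ?_
    · simpa using tendsto_const_nhds.add
        (tendsto_one_div_add_atTop_nhds_zero_nat (𝕜 := ℝ≥0))
    · intro n
      change q.2 ≤ _ / _
      rw [le_div_iff₀ (hpos n), mul_comm]
      exact (Nat.lt_floor_add_one _).le
    · intro n
      change _ / _ ≤ q.2 + 1 / ((n : ℝ≥0) + 1)
      rw [div_le_iff₀ (hpos n), add_mul _ _ ((n : ℝ≥0) + 1), div_mul_cancel₀ _ (hpos n).ne',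
        mul_comm q.2]
      gcongr
      exact Nat.floor_le (by positivity)
  · change q.2 ≤ _ / _
    rw [le_div_iff₀ (hpos n), mul_comm]
    exact (Nat.lt_floor_add_one _).le

theorem D.measurable (u : D) : Measurable u.1 :=
  measurable_eval_prod.comp measurable_prodMk_left

end CadlagPaths

section Filtrations

theorem measurable_natF [MeasurableSpace E] (Y : ℝ≥0 → Ω → E) {s t : ℝ≥0} (h : s ≤ t) :
    Measurable[natF Y t] (Y s) :=
  (comap_measurable _).mono (le_iSup₂ (f := fun s (_ : s ∈ Set.Iic t) =>
    MeasurableSpace.comap (Y s) inferInstance) s h) le_rfl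

theorem natF_mono [MeasurableSpace E] (Y : ℝ≥0 → Ω → E) : Monotone (natF Y) :=
  fun _ _ h => biSup_mono fun _ hs => le_trans hs h

variable [MeasurableSpace Ω] (μ : Measure Ω)

theorem rcF_mono [MeasurableSpace E] (Y : ℝ≥0 → Ω → E) : Monotone (rcF μ Y) :=
  fun _ _ h => biInf_mono fun _ hs => lt_of_le_of_lt h hs

theorem natF_le_rcF [MeasurableSpace E] (Y : ℝ≥0 → Ω → E) (t : ℝ≥0) :
    natF Y t ≤ rcF μ Y t :=
  le_iInf₂ fun _ hu => (natF_mono Y (le_of_lt hu)).trans le_sup_left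

theorem rcF_le [MeasurableSpace E] (Y : ℝ≥0 → Ω → E) {t u : ℝ≥0} (h : t < u) :
    rcF μ Y t ≤ natF Y u ⊔ nullSets μ :=
  iInf₂_le u h

theorem measurableSet_eventually_nat {α : Type*} {m : MeasurableSpace α} {S : ℕ → Set α}
    (h : ∀ᶠ n in atTop, MeasurableSet (S n)) :
    MeasurableSet {a | ∀ᶠ n in atTop, a ∈ S n} := by
  obtain ⟨M, hM⟩ := eventually_atTop.1 h
  have : {a | ∀ᶠ n in atTop, a ∈ S n} = ⋃ m : ℕ, ⋂ n : ℕ, S (max m M + n) := by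
    ext a
    simp only [mem_ofPred_eq, eventually_atTop, mem_iUnion, mem_iInter]
    constructor
    · rintro ⟨m, hm⟩
      exact ⟨m, fun n => hm _ (by omega)⟩
    · rintro ⟨m, hm⟩
      refine ⟨max m M, fun n hn => ?_⟩
      obtain ⟨k, rfl⟩ := Nat.exists_eq_add_of_le hn
      exact hm k
  rw [this]
  exact .iUnion fun m => .iInter fun n => hM _ (by omega)

/-- If each `S n` lies in the raw filtration at time `v n` and `v n → t`, then the lower limit of
the sets `S n` lies in the right-continuous completed filtration at `t`. -/
theorem measurableSet_rcF_eventually [MeasurableSpace E] (Y : ℝ≥0 → Ω → E) {t : ℝ≥0}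
    {v : ℕ → ℝ≥0} (hv : Tendsto v atTop (𝓝 t)) {S : ℕ → Set Ω}
    (hS : ∀ n, MeasurableSet[natF Y (v n)] (S n)) :
    MeasurableSet[rcF μ Y t] {ω | ∀ᶠ n in atTop, ω ∈ S n} := by
  refine MeasurableSpace.measurableSet_iInf.2 fun u =>
    MeasurableSpace.measurableSet_iInf.2 fun hu => ?_
  refine (le_sup_left : natF Y u ≤ _) _ (measurableSet_eventually_nat ?_)
  filter_upwards [hv.eventually_lt_const hu] with n hn
  exact natF_mono Y hn.le _ (hS n)

end Filtrations

section Predictable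

variable [MeasurableSpace Ω]

theorem measurableSet_predSigma_of_indicator {F : ℝ≥0 → MeasurableSpace Ω}
    {S : Set (Ω × ℝ≥0)}
    (hl : ∀ ω t, ContinuousWithinAt (fun s => S.indicator (fun _ => (1 : ℝ)) (ω, s)) (Set.Iio t) t)
    (ha : ∀ t, Measurable[F t] fun ω => S.indicator (fun _ => (1 : ℝ)) (ω, t)) :
    MeasurableSet[predSigma F] S := by
  refine le_iSup₂ (f := fun f (_ : f ∈ {f : Ω × ℝ≥0 → ℝ |
      (∀ ω t, ContinuousWithinAt (fun s => f (ω, s)) (Set.Iio t) t) ∧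
      ∀ t, Measurable[F t] fun ω => f (ω, t)}) =>
    MeasurableSpace.comap f inferInstance) (S.indicator fun _ => (1 : ℝ)) ⟨hl, ha⟩ S
      ⟨{1}, measurableSet_singleton _, ?_⟩
  ext p
  by_cases hp : p ∈ S <;> simp [hp]

theorem measurableSet_predSigma_prod_Ioi {F : ℝ≥0 → MeasurableSpace Ω} (hF : Monotone F)
    {r : ℝ≥0} {B : Set Ω} (hB : MeasurableSet[F r] B) :
    MeasurableSet[predSigma F] (B ×ˢ Set.Ioi r) := by
  refine measurableSet_predSigma_of_indicator (fun ω t => ?_) fun t => ?_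
  · rcases le_or_gt t r with h | h
    · refine (continuousWithinAt_const (b := (0 : ℝ))).congr (fun s hs => ?_) ?_
      · exact indicator_of_notMem (fun hm => absurd hm.2 (not_lt.2 (hs.le.trans h))) _
      · exact indicator_of_notMem (fun hm => absurd hm.2 (not_lt.2 h)) _
    · refine ContinuousAt.continuousWithinAt ?_
      refine (continuousAt_const (y := B.indicator (fun _ => (1 : ℝ)) ω)).congr ?_
      filter_upwards [lt_mem_nhds h] with s hs
      by_cases hω : ω ∈ B <;> simp [hω, hs]
  · by_cases h : r < t
    · have : (fun ω => (B ×ˢ Set.Ioi r).indicator (fun _ => (1 : ℝ)) (ω, t)) =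
          B.indicator fun _ => 1 := by
        ext ω
        by_cases hω : ω ∈ B <;> simp [hω, h]
      rw [this]
      exact (measurable_indicator_const_iff (1 : ℝ)).2 (hF h.le _ hB)
    · have : (fun ω => (B ×ˢ Set.Ioi r).indicator (fun _ => (1 : ℝ)) (ω, t)) = fun _ => 0 := by
        ext ω
        simp [h]
      rw [this]
      exact measurable_const

theorem measurableSet_predSigma_prod_zero {F : ℝ≥0 → MeasurableSpace Ω}
    {B : Set Ω} (hB : MeasurableSet[F 0] B) :
    MeasurableSet[predSigma F] (B ×ˢ {(0 : ℝ≥0)}) := by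
  refine measurableSet_predSigma_of_indicator (fun ω t => ?_) fun t => ?_
  · rcases eq_or_ne t 0 with rfl | h
    · simp [ContinuousWithinAt]
    · refine ContinuousAt.continuousWithinAt ?_
      refine (continuousAt_const (y := (0 : ℝ))).congr ?_
      filter_upwards [isOpen_ne.mem_nhds h] with s hs
      exact (indicator_of_notMem (fun hm => hs hm.2) _).symm
  · rcases eq_or_ne t 0 with rfl | h
    · have : (fun ω => (B ×ˢ {(0 : ℝ≥0)}).indicator (fun _ => (1 : ℝ)) (ω, 0)) =
          B.indicator fun _ => 1 := by
        ext ω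
        by_cases hω : ω ∈ B <;> simp [hω]
      rw [this]
      exact (measurable_indicator_const_iff (1 : ℝ)).2 hB
    · have : (fun ω => (B ×ˢ {(0 : ℝ≥0)}).indicator (fun _ => (1 : ℝ)) (ω, t)) = fun _ => 0 := by
        ext ω
        simp [h]
      rw [this]
      exact measurable_const

/-- The predictable σ-algebra is generated by the predictable rectangles. -/
theorem predSigma_le {F : ℝ≥0 → MeasurableSpace Ω} {m : MeasurableSpace (Ω × ℝ≥0)}
    (hpos : ∀ r B, MeasurableSet[F r] B → MeasurableSet[m] (B ×ˢ Set.Ioi r))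
    (hzero : ∀ B, MeasurableSet[F 0] B → MeasurableSet[m] (B ×ˢ {(0 : ℝ≥0)})) :
    predSigma F ≤ m := by
  refine iSup₂_le fun f ⟨hl, ha⟩ => ?_
  rw [← measurable_iff_comap_le]
  have hn (n : ℕ) : (0 : ℝ≥0) < n + 1 := by positivity
  have happrox (n : ℕ) : Measurable[m] fun p : Ω × ℝ≥0 =>
      f (p.1, ((⌈((n : ℝ≥0) + 1) * p.2⌉₊ - 1 : ℕ) : ℝ≥0) / (n + 1)) := by
    intro C hC
    have hdecomp : (fun p : Ω × ℝ≥0 =>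
        f (p.1, ((⌈((n : ℝ≥0) + 1) * p.2⌉₊ - 1 : ℕ) : ℝ≥0) / (n + 1))) ⁻¹' C =
        (((fun ω => f (ω, 0)) ⁻¹' C) ×ˢ {(0 : ℝ≥0)}) ∪
        ⋃ k : ℕ, (((fun ω => f (ω, (k : ℝ≥0) / (n + 1))) ⁻¹' C) ×ˢ
            Set.Ioi ((k : ℝ≥0) / (n + 1))) \
          (univ ×ˢ Set.Ioi (((k + 1 : ℕ) : ℝ≥0) / (n + 1))) := by
      ext ⟨ω, t⟩
      simp only [mem_preimage, mem_union, mem_prod, mem_singleton_iff, mem_iUnion, Set.mem_sdiff,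
        mem_Ioi, mem_univ, true_and, not_lt]
      have hkey (k : ℕ) : ((k : ℝ≥0) / (n + 1) < t ∧ t ≤ ((k + 1 : ℕ) : ℝ≥0) / (n + 1)) ↔
          ⌈((n : ℝ≥0) + 1) * t⌉₊ = k + 1 := by
        rw [Nat.ceil_eq_iff k.succ_ne_zero, div_lt_iff₀ (hn n), le_div_iff₀ (hn n),
          mul_comm t]
        simp
      constructor
      · intro h
        rcases eq_or_ne t 0 with rfl | ht
        · left
          simpa using h
        · right
          have hc : 0 < ⌈((n : ℝ≥0) + 1) * t⌉₊ :=
            Nat.ceil_pos.2 (mul_pos (hn n) (pos_iff_ne_zero.2 ht))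
          have hk := (hkey (⌈((n : ℝ≥0) + 1) * t⌉₊ - 1)).2 (by omega)
          exact ⟨_, ⟨h, hk.1⟩, hk.2⟩
      · rintro (⟨h, rfl⟩ | ⟨k, ⟨h, h1⟩, h2⟩)
        · simpa using h
        · rw [(hkey k).1 ⟨h1, h2⟩]
          simpa using h
    rw [hdecomp]
    exact (hzero _ (ha 0 hC)).union (.iUnion fun k =>
      (hpos _ _ (ha _ hC)).diff (hpos _ _ MeasurableSet.univ))
  refine @measurable_of_tendsto_metrizable _ _ m _ _ _ _ _ _ happrox
    (tendsto_pi_nhds.2 fun p => ?_)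
  rcases eq_or_ne p.2 0 with h0 | h0
  · obtain ⟨ω, t⟩ := p
    obtain rfl : t = 0 := h0
    simp
  have hlt (n : ℕ) : ((⌈((n : ℝ≥0) + 1) * p.2⌉₊ - 1 : ℕ) : ℝ≥0) / (n + 1) < p.2 := by
    rw [div_lt_iff₀ (hn n), mul_comm p.2, ← Nat.lt_ceil]
    have : 0 < ⌈((n : ℝ≥0) + 1) * p.2⌉₊ :=
      Nat.ceil_pos.2 (mul_pos (hn n) (pos_iff_ne_zero.2 h0))
    omega
  refine (hl p.1 p.2).tendsto.comp (tendsto_nhdsWithin_iff.2 ⟨?_, .of_forall hlt⟩)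
  refine tendsto_of_tendsto_of_tendsto_of_le_of_le
    (g := fun n : ℕ => p.2 - 1 / ((n : ℝ≥0) + 1)) (h := fun _ => p.2) ?_ tendsto_const_nhds
    (fun n => ?_) fun n => (hlt n).le
  · simpa using tendsto_const_nhds.sub
      (tendsto_one_div_add_atTop_nhds_zero_nat (𝕜 := ℝ≥0))
  · change p.2 - 1 / ((n : ℝ≥0) + 1) ≤ _ / _
    rw [tsub_le_iff_right, ← add_div, le_div_iff₀ (hn n), mul_comm p.2]
    refine (Nat.le_ceil _).trans ?_
    norm_cast
    omega

end Predictable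

/-- A nonnegative function measurable modulo a σ-filter with respect to a σ-algebra pulled back
along `φ` agrees, up to the filter, with a measurable function of `φ`. -/
theorem exists_measurable_comp_eventuallyEq {α β : Type*} {m : MeasurableSpace β} {φ : α → β}
    {l : Filter α} [CountableInterFilter l] {f : α → ℝ≥0∞}
    (hf : Measurable[@eventuallyMeasurableSpace α (m.comap φ) l _] f) :
    ∃ g : β → ℝ≥0∞, Measurable g ∧ f =ᶠ[l] g ∘ φ := by
  refine @Measurable.ennreal_induction α (@eventuallyMeasurableSpace α (m.comap φ) l _)
    (fun f => ∃ g : β → ℝ≥0∞, Measurable g ∧ f =ᶠ[l] g ∘ φ) ?_ ?_ ?_ f hf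
  · rintro c s ⟨_, ⟨t, ht, rfl⟩, hst⟩
    refine ⟨t.indicator fun _ => c, measurable_const.indicator ht, ?_⟩
    filter_upwards [hst] with a ha
    have ha' : a ∈ s ↔ φ a ∈ t := iff_of_eq ha
    by_cases h : φ a ∈ t
    · simp [h, ha'.2 h]
    · simp [h, mt ha'.1 h]
  · rintro f₁ f₂ - - - ⟨g₁, hg₁, h₁⟩ ⟨g₂, hg₂, h₂⟩
    exact ⟨g₁ + g₂, hg₁.add hg₂, h₁.add h₂⟩
  · intro f _ _ h
    choose g hg hfg using h
    refine ⟨fun b => ⨆ n, g n b, .iSup hg, ?_⟩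
    filter_upwards [eventually_countable_forall.2 hfg] with a ha
    exact iSup_congr ha

section TimeChange

/-- The σ-algebra on pairs of paths generated by `z_s` and `x_{z_s}` for `s ≤ u`. -/
abbrev timeChangeSigma (u : ℝ≥0) : MeasurableSpace (D × D) :=
  ⨆ s ∈ Set.Iic u,
    MeasurableSpace.comap (fun q : D × D => (q.1.1 (q.2.1 s).toNNReal, (q.2.1 s).toNNReal))
      inferInstance

theorem timeChangeSigma_le (u : ℝ≥0) : timeChangeSigma u ≤ Prod.instMeasurableSpace := by
  refine iSup₂_le fun s _ => ?_
  rw [← measurable_iff_comap_le]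
  have h : Measurable fun q : D × D => (q.2.1 s).toNNReal :=
    ((measurable_eval s).comp measurable_snd).real_toNNReal
  exact (measurable_eval_prod.comp (measurable_fst.prodMk h)).prodMk h

theorem measurable_timeChangeSigma {s u : ℝ≥0} (h : s ≤ u) :
    Measurable[timeChangeSigma u]
      fun q : D × D => (q.1.1 (q.2.1 s).toNNReal, (q.2.1 s).toNNReal) :=
  (comap_measurable _).mono (le_iSup₂ (f := fun s (_ : s ∈ Set.Iic u) =>
    MeasurableSpace.comap (fun q : D × D => (q.1.1 (q.2.1 s).toNNReal, (q.2.1 s).toNNReal))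
      inferInstance) s h) le_rfl

/-- The path-valued map of a càdlàg process. -/
def path (Y : ℝ≥0 → Ω → ℝ) (hY : ∀ ω, IsCadlag fun s => Y s ω) (ω : Ω) : D :=
  ⟨fun s => Y s ω, hY ω⟩

variable (X : ℝ≥0 → Ω → ℝ) (Z : ℝ≥0 → Ω → ℝ≥0)
  (hX : ∀ ω, IsCadlag fun s => X s ω) (hZ : ∀ ω, IsCadlag fun s => (Z s ω : ℝ))

theorem natF_sup_le_comap_timeChangeSigma (u : ℝ≥0) :
    natF (fun s ω => X (Z s ω) ω) u ⊔ natF Z u ≤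
      (timeChangeSigma u).comap fun ω => (path X hX ω, path (fun s ω => (Z s ω : ℝ)) hZ ω) := by
  have hm (s : ℝ≥0) (hs : s ≤ u) := (measurable_timeChangeSigma hs).comp
    (comap_measurable (m := timeChangeSigma u)
      fun ω => (path X hX ω, path (fun s ω => (Z s ω : ℝ)) hZ ω))
  refine sup_le (iSup₂_le fun s hs => ?_) (iSup₂_le fun s hs => ?_)
  · rw [← measurable_iff_comap_le]
    simpa [Function.comp_def, path] using measurable_fst.comp (hm s hs)
  · rw [← measurable_iff_comap_le]
    simpa [Function.comp_def, path] using measurable_snd.comp (hm s hs)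

theorem measurable_timeChangeSigma_fixed_left (x : D) (u : ℝ≥0) :
    Measurable[natF Z u, timeChangeSigma u]
      fun ω => (x, path (fun s ω => (Z s ω : ℝ)) hZ ω) := by
  refine Measurable.of_comap_le ?_
  simp only [timeChangeSigma, MeasurableSpace.comap_iSup]
  refine iSup₂_le fun s hs => ?_
  rw [MeasurableSpace.comap_comp, ← measurable_iff_comap_le]
  have h := measurable_natF Z hs
  simpa [Function.comp_def, path] using (x.measurable.comp h).prodMk h

theorem measurable_timeChangeSigma_fixed_right (hZmono : ∀ ω, Monotone fun s => Z s ω)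
    (ω' : Ω) (u : ℝ≥0) :
    Measurable[natF X (Z u ω'), timeChangeSigma u]
      fun ω => (path X hX ω, path (fun s ω => (Z s ω : ℝ)) hZ ω') := by
  refine Measurable.of_comap_le ?_
  simp only [timeChangeSigma, MeasurableSpace.comap_iSup]
  refine iSup₂_le fun s hs => ?_
  rw [MeasurableSpace.comap_comp, ← measurable_iff_comap_le]
  have h := measurable_natF X (hZmono ω' hs)
  simpa [Function.comp_def, path] using h.prodMk measurable_const

variable [MeasurableSpace Ω] (μ : Measure Ω)

/-- The jointly measurable subsets of `D × D × ℝ≥0` whose sections in the first, respectively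
second, path variable are predictable for the appropriate filtration. -/
abbrev sectionSigma : MeasurableSpace (D × D × ℝ≥0) :=
  inferInstance ⊓
    ((⨅ ω' : Ω, (predSigma (rcF μ Z)).map fun p : Ω × ℝ≥0 =>
        (path X hX ω', path (fun s ω => (Z s ω : ℝ)) hZ p.1, p.2)) ⊓
      ⨅ ω' : Ω, (predSigma fun t => rcF μ X (Z t ω')).map fun p : Ω × ℝ≥0 =>
        (path X hX p.1, path (fun s ω => (Z s ω : ℝ)) hZ ω', p.2))

variable {X Z hX hZ μ}

theorem measurableSet_sectionSigma {S : Set (D × D × ℝ≥0)} (h : MeasurableSet S)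
    (h₁ : ∀ ω', MeasurableSet[predSigma (rcF μ Z)] ((fun p : Ω × ℝ≥0 =>
        (path X hX ω', path (fun s ω => (Z s ω : ℝ)) hZ p.1, p.2)) ⁻¹' S))
    (h₂ : ∀ ω', MeasurableSet[predSigma fun t => rcF μ X (Z t ω')] ((fun p : Ω × ℝ≥0 =>
        (path X hX p.1, path (fun s ω => (Z s ω : ℝ)) hZ ω', p.2)) ⁻¹' S)) :
    MeasurableSet[sectionSigma X Z hX hZ μ] S := by
  exact MeasurableSpace.measurableSet_inf.2 ⟨h, MeasurableSpace.measurableSet_inf.2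
    ⟨MeasurableSpace.measurableSet_iInf.2 h₁, MeasurableSpace.measurableSet_iInf.2 h₂⟩⟩

theorem measurableSet_sectionSigma_Ioi (hZmono : ∀ ω, Monotone fun s => Z s ω)
    {u : ℝ≥0} {S : Set (D × D)} (hS : MeasurableSet[timeChangeSigma u] S) :
    MeasurableSet[sectionSigma X Z hX hZ μ]
      {q : D × D × ℝ≥0 | (q.1, q.2.1) ∈ S ∧ u < q.2.2} := by
  refine measurableSet_sectionSigma ?_ (fun ω' => ?_) fun ω' => ?_
  · have h₁ : Measurable fun q : D × D × ℝ≥0 => (q.1, q.2.1) := by fun_prop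
    exact (h₁ (timeChangeSigma_le u _ hS)).inter
      (measurableSet_lt measurable_const (by fun_prop))
  · exact measurableSet_predSigma_prod_Ioi (rcF_mono μ Z)
      (natF_le_rcF μ Z u _ (measurable_timeChangeSigma_fixed_left Z hZ (path X hX ω') u hS))
  · exact measurableSet_predSigma_prod_Ioi (F := fun t => rcF μ X (Z t ω'))
      (fun _ _ h => rcF_mono μ X (hZmono ω' h))
      (natF_le_rcF μ X _ _
        (measurable_timeChangeSigma_fixed_right X Z hX hZ hZmono ω' u hS))

theorem measurableSet_sectionSigma_zero (hZmono : ∀ ω, Monotone fun s => Z s ω)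
    {S : ℕ → Set (D × D)}
    (hS : ∀ n : ℕ, MeasurableSet[timeChangeSigma (1 / ((n : ℝ≥0) + 1))] (S n)) :
    MeasurableSet[sectionSigma X Z hX hZ μ]
      {q : D × D × ℝ≥0 | (∀ᶠ n in atTop, (q.1, q.2.1) ∈ S n) ∧ q.2.2 = 0} := by
  have hlim : Tendsto (fun n : ℕ => 1 / ((n : ℝ≥0) + 1)) atTop (𝓝 0) :=
    tendsto_one_div_add_atTop_nhds_zero_nat (𝕜 := ℝ≥0)
  refine measurableSet_sectionSigma ?_ (fun ω' => ?_) fun ω' => ?_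
  · have h₁ : Measurable fun q : D × D × ℝ≥0 => (q.1, q.2.1) := by fun_prop
    exact (h₁ (measurableSet_eventually_nat
      (.of_forall fun n => timeChangeSigma_le _ _ (hS n)))).inter
      (measurableSet_eq_fun (by fun_prop) measurable_const)
  · exact measurableSet_predSigma_prod_zero (measurableSet_rcF_eventually μ Z hlim fun n =>
      measurable_timeChangeSigma_fixed_left Z hZ (path X hX ω') _ (hS n))
  · have hcont : Tendsto (fun n : ℕ => Z (1 / ((n : ℝ≥0) + 1)) ω') atTop (𝓝 (Z 0 ω')) := by
      rw [← NNReal.tendsto_coe]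
      exact ((hZ ω').1 0).tendsto.comp
        (tendsto_nhdsWithin_iff.2 ⟨hlim, .of_forall fun n => zero_le (a := 1 / ((n : ℝ≥0) + 1))⟩)
    exact measurableSet_predSigma_prod_zero (F := fun t => rcF μ X (Z t ω'))
      (measurableSet_rcF_eventually μ X hcont fun n =>
        measurable_timeChangeSigma_fixed_right X Z hX hZ hZmono ω' _ (hS n))

theorem exists_timeChangeSigma_ae_eq (hX : ∀ ω, IsCadlag fun s => X s ω)
    (hZ : ∀ ω, IsCadlag fun s => (Z s ω : ℝ)) {r u : ℝ≥0} (h : r < u) {B : Set Ω}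
    (hB : MeasurableSet[Ffilt μ X Z r] B) :
    ∃ S, MeasurableSet[timeChangeSigma u] S ∧ ∀ᵐ ω ∂μ,
      (ω ∈ B ↔ (path X hX ω, path (fun s ω => (Z s ω : ℝ)) hZ ω) ∈ S) := by
  have hnull : nullSets μ ≤ eventuallyMeasurableSpace ((timeChangeSigma u).comap
      fun ω => (path X hX ω, path (fun s ω => (Z s ω : ℝ)) hZ ω)) (ae μ) :=
    MeasurableSpace.generateFrom_le fun s hs =>
      ⟨∅, @MeasurableSet.empty _ (_), ae_eq_empty.2 hs⟩
  have hraw := (natF_sup_le_comap_timeChangeSigma X Z hX hZ u).trans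
    (le_eventuallyMeasurableSpace (l := ae μ))
  have hle : Ffilt μ X Z r ≤ eventuallyMeasurableSpace ((timeChangeSigma u).comap
      fun ω => (path X hX ω, path (fun s ω => (Z s ω : ℝ)) hZ ω)) (ae μ) :=
    sup_le (sup_le
      ((rcF_le μ _ h).trans (sup_le (le_sup_left.trans hraw) hnull))
      ((rcF_le μ _ h).trans (sup_le (le_sup_right.trans hraw) hnull))) hnull
  obtain ⟨_, ⟨S, hS, rfl⟩, hBS⟩ := hle _ hB
  refine ⟨S, hS, ?_⟩
  filter_upwards [hBS] with ω hω using iff_of_eq hω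

theorem predSigma_Ffilt_le (hX : ∀ ω, IsCadlag fun s => X s ω)
    (hZ : ∀ ω, IsCadlag fun s => (Z s ω : ℝ)) (hZmono : ∀ ω, Monotone fun s => Z s ω) :
    predSigma (Ffilt μ X Z) ≤ eventuallyMeasurableSpace
      ((sectionSigma X Z hX hZ μ).comap fun p : Ω × ℝ≥0 =>
        (path X hX p.1, path (fun s ω => (Z s ω : ℝ)) hZ p.1, p.2))
      ((ae μ).comap Prod.fst) := by
  refine predSigma_le (fun r B hB => ?_) fun B hB => ?_
  · have hpos (n : ℕ) : r < r + 1 / ((n : ℝ≥0) + 1) := lt_add_of_pos_right _ (by positivity)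
    choose S hS hBS using fun n : ℕ => exists_timeChangeSigma_ae_eq hX hZ (hpos n) hB
    have hUnion : B ×ˢ Set.Ioi r =
        ⋃ n : ℕ, B ×ˢ Set.Ioi (r + 1 / ((n : ℝ≥0) + 1)) := by
      ext ⟨ω, t⟩
      simp only [mem_prod, mem_Ioi, mem_iUnion]
      constructor
      · rintro ⟨hω, ht⟩
        have hlim : Tendsto (fun n : ℕ => r + 1 / ((n : ℝ≥0) + 1)) atTop (𝓝 r) := by
          simpa using tendsto_const_nhds.add
            (tendsto_one_div_add_atTop_nhds_zero_nat (𝕜 := ℝ≥0))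
        obtain ⟨n, hn⟩ := (hlim.eventually_lt_const ht).exists
        exact ⟨n, hω, hn⟩
      · rintro ⟨n, hω, ht⟩
        exact ⟨hω, (hpos n).trans ht⟩
    rw [hUnion]
    refine MeasurableSet.iUnion fun n => ?_
    refine ⟨_, ⟨_, measurableSet_sectionSigma_Ioi hZmono (hS n), rfl⟩, ?_⟩
    filter_upwards [(hBS n).comap Prod.fst] with p hp
    exact propext (and_congr_left fun _ => hp)
  · have hpos (n : ℕ) : (0 : ℝ≥0) < 1 / ((n : ℝ≥0) + 1) := by positivity
    choose S hS hBS using fun n : ℕ => exists_timeChangeSigma_ae_eq hX hZ (hpos n) hB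
    refine ⟨_, ⟨_, measurableSet_sectionSigma_zero hZmono hS, rfl⟩, ?_⟩
    filter_upwards [(ae_all_iff.2 hBS).comap Prod.fst] with p hp
    refine propext (and_congr_left fun _ => ?_)
    exact ⟨fun h => .of_forall fun n => (hp n).1 h,
      fun h => let ⟨n, hn⟩ := h.exists; (hp n).2 hn⟩

end TimeChange

/-- Proposition 2, second claim: `𝒫 = predSigma (ℱ_·)`,
`𝒫^Z = predSigma (ℱ^Z_·)` and `𝒫^X_{Z(ω̃)} = predSigma ((ℱ^X_{Z_t(ω̃)})_t)`. -/
theorem stmt_6 [MeasurableSpace Ω] (μ : Measure Ω) [IsProbabilityMeasure μ] [μ.IsComplete]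
    (X : ℝ≥0 → Ω → ℝ) (Z : ℝ≥0 → Ω → ℝ≥0)
    (hXmeas : ∀ s, Measurable (X s)) (hZmeas : ∀ s, Measurable (Z s))
    (hX : ∀ ω, IsCadlag fun s => X s ω)
    (hZ : ∀ ω, IsCadlag fun s => (Z s ω : ℝ))
    (hZmono : ∀ ω, Monotone fun s => Z s ω)
    (hindep : ProbabilityTheory.Indep (sigmaProc X) (sigmaProc Z) μ)
    (A : Ω × ℝ≥0 → ℝ) (hA0 : ∀ p, 0 ≤ A p)
    (hA : Measurable[predSigma (Ffilt μ X Z)] A) :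
    ∃ H : D × D × ℝ≥0 → ℝ, Measurable H ∧ (∀ q, 0 ≤ H q) ∧
      (∃ N : Set Ω, μ N = 0 ∧ ∀ ω ∉ N, ∀ t : ℝ≥0,
        A (ω, t) = H (⟨fun s => X s ω, hX ω⟩, ⟨fun s => (Z s ω : ℝ), hZ ω⟩, t)) ∧
      (∀ᵐ ω' ∂μ, Measurable[predSigma (rcF μ Z)]
        fun p : Ω × ℝ≥0 =>
          H (⟨fun s => X s ω', hX ω'⟩, ⟨fun s => (Z s p.1 : ℝ), hZ p.1⟩, p.2)) ∧
      (∀ᵐ ω' ∂μ, Measurable[predSigma fun t => rcF μ X (Z t ω')]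
        fun p : Ω × ℝ≥0 =>
          H (⟨fun s => X s p.1, hX p.1⟩, ⟨fun s => (Z s ω' : ℝ), hZ ω'⟩, p.2)) := by
  obtain ⟨G, hG, hAG⟩ := exists_measurable_comp_eventuallyEq
    (hA.mono (predSigma_Ffilt_le hX hZ hZmono) le_rfl).ennreal_ofReal
  have hH : Measurable[sectionSigma X Z hX hZ μ] fun q => (G q).toReal := hG.ennreal_toReal
  refine ⟨fun q => (G q).toReal, hH.mono inf_le_left le_rfl, fun q => ENNReal.toReal_nonneg,
    ?_, .of_forall fun ω' => ?_, .of_forall fun ω' => ?_⟩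
  · obtain ⟨T, hT, hTsub⟩ := mem_comap.1 hAG
    refine ⟨Tᶜ, hT, fun ω hω t => ?_⟩
    have h : ENNReal.ofReal (A (ω, t)) = G (path X hX ω, path (fun s ω => (Z s ω : ℝ)) hZ ω, t) :=
      hTsub (show (ω, t) ∈ Prod.fst ⁻¹' T from not_not.1 hω)
    change A (ω, t) = (G (path X hX ω, path (fun s ω => (Z s ω : ℝ)) hZ ω, t)).toReal
    rw [← h, ENNReal.toReal_ofReal (hA0 _)]
  · have h := ((inf_le_right.trans inf_le_left).trans (iInf_le _ ω') :
      sectionSigma X Z hX hZ μ ≤ _)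
    exact hH.comp (Measurable.of_le_map h)
  · have h := ((inf_le_right.trans inf_le_right).trans (iInf_le _ ω') :
      sectionSigma X Z hX hZ μ ≤ _)
    exact hH.comp (Measurable.of_le_map h)
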